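/- Let k ≥ 2 be an even integer, N a squarefree positive integer, ε an Atkin–Lehner eigensystem for Γ₀(N), and p a prime dividing N. For m ≥ 1 set a(m) = Σ_{d∣N} ε(d) d^{k/2} σ_{k−1}(m/d), with σ_{k−1}(m/d) = 0 when d ∤ m. Let ℓ be a prime such that ℓ divides (1 + ε(p) p^{k/2})(1 + ε(p) p^{k/2−1}). Then for every integer n ≥ 1: a(pn) ≡ −ε(p) p^{k/2−1} a(n) (mod ℓ). (That is, the mod ℓ Eisenstein series 𝓔_{k,N}^{(ε)} is an eigenfunction of the operator U_p with eigenvalue −ε(p) p^{k/2−1}.) -/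

import Mathlib

open Finset

/-- The divisors of `p * m` are the multiples `p * e` of `p`, with `e ∣ m`, together with the
divisors of `m` not divisible by `p`. -/
theorem sum_divisors_prime_mul {R : Type*} [AddCommMonoid R] {p m : ℕ} (hp : p.Prime) (hm : m ≠ 0)
    (f : ℕ → R) :
    ∑ e ∈ (p * m).divisors, f e =
      ∑ e ∈ m.divisors, f (p * e) + ∑ e ∈ m.divisors with ¬ p ∣ e, f e := by
  rw [← Finset.sum_filter_add_sum_filter_not (p * m).divisors (fun e => p ∣ e)]
  congr 1
  · symm
    refine Finset.sum_bij (fun e _ => p * e) ?_ ?_ ?_ ?_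
    · intro e he
      simp only [Finset.mem_filter, Nat.mem_divisors] at he ⊢
      exact ⟨⟨Nat.mul_dvd_mul_left p he.1, Nat.mul_ne_zero hp.ne_zero hm⟩, Dvd.intro e rfl⟩
    · intro e₁ _ e₂ _ h
      exact Nat.eq_of_mul_eq_mul_left hp.pos h
    · intro b hb
      simp only [Finset.mem_filter, Nat.mem_divisors] at hb
      obtain ⟨⟨h, _⟩, c, rfl⟩ := hb
      exact ⟨c, Nat.mem_divisors.2 ⟨Nat.dvd_of_mul_dvd_mul_left hp.pos h, hm⟩, rfl⟩
    · intros
      rfl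
  · refine Finset.sum_congr ?_ fun _ _ => rfl
    ext e
    simp only [Finset.mem_filter, Nat.mem_divisors]
    constructor
    · rintro ⟨⟨h, _⟩, he⟩
      exact ⟨⟨((Nat.coprime_comm.1 ((Nat.Prime.coprime_iff_not_dvd hp).2 he)).dvd_of_dvd_mul_left h),
        hm⟩, he⟩
    · rintro ⟨⟨h, _⟩, he⟩
      exact ⟨⟨h.mul_left p, Nat.mul_ne_zero hp.ne_zero hm⟩, he⟩

/-- The Hecke recursion for divisor power sums at a prime `p`. -/
theorem sum_divisors_pow_prime_mul {p m : ℕ} (hp : p.Prime) (hm : m ≠ 0) (q : ℕ) :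
    ∑ e ∈ (p * m).divisors, (e : ℤ) ^ q =
      (1 + (p : ℤ) ^ q) * ∑ e ∈ m.divisors, (e : ℤ) ^ q -
        (p : ℤ) ^ q * (if p ∣ m then ∑ e ∈ (m / p).divisors, (e : ℤ) ^ q else 0) := by
  rw [sum_divisors_prime_mul hp hm]
  simp only [Nat.cast_mul, mul_pow, ← Finset.mul_sum]
  split_ifs with h
  · obtain ⟨c, rfl⟩ := h
    have hc : c ≠ 0 := right_ne_zero_of_mul hm
    rw [Nat.mul_div_cancel_left c hp.pos]
    have h₁ := sum_divisors_prime_mul hp hc (fun e => (e : ℤ) ^ q)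
    simp only [Nat.cast_mul, mul_pow, ← Finset.mul_sum] at h₁
    have h₂ : ({e ∈ (p * c).divisors | ¬ p ∣ e}) = {e ∈ c.divisors | ¬ p ∣ e} := by
      ext e
      simp only [Finset.mem_filter, Nat.mem_divisors]
      constructor
      · rintro ⟨⟨h, _⟩, he⟩
        exact ⟨⟨((Nat.coprime_comm.1
          ((Nat.Prime.coprime_iff_not_dvd hp).2 he)).dvd_of_dvd_mul_left h), hc⟩, he⟩
      · rintro ⟨⟨h, _⟩, he⟩
        exact ⟨⟨h.mul_left p, hm⟩, he⟩
    rw [h₂]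
    linear_combination -h₁
  · rw [Finset.filter_true_of_mem]
    · ring
    · intro e he hpe
      exact h (hpe.trans (Nat.dvd_of_mem_divisors he))

/-- Let k = 2j ≥ 2 be even, N squarefree, ε an Atkin–Lehner
eigensystem for Γ₀(N), p a prime dividing N, and
a(m) = Σ_{d∣N} ε(d) d^{k/2} σ_{k−1}(m/d) (σ_{k−1}(m/d) = 0 when d ∤ m).
If a prime ℓ divides (1 + ε(p) p^{k/2})(1 + ε(p) p^{k/2−1}), then for every
n ≥ 1:  a(pn) ≡ −ε(p) p^{k/2−1} a(n) (mod ℓ). -/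
theorem eisenstein_Up_eigenfunction_mod_ell
    (k j : ℕ) (hj : 1 ≤ j) (hk : k = 2 * j)
    (N : ℕ) (hN : Squarefree N) (hN0 : 0 < N)
    (ε : ℕ → ℤ) (hε1 : ε 1 = 1)
    (hεpm : ∀ d, d ∣ N → ε d = 1 ∨ ε d = -1)
    (hεmul : ∀ d₁ d₂, d₁ ∣ N → d₂ ∣ N → Nat.Coprime d₁ d₂ → ε (d₁ * d₂) = ε d₁ * ε d₂)
    (p : ℕ) (hp : p.Prime) (hpN : p ∣ N)
    (a : ℕ → ℤ)
    (ha : ∀ m, 1 ≤ m → a m = ∑ d ∈ N.divisors, ε d * (d : ℤ) ^ j *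
        (if d ∣ m then ∑ e ∈ (m / d).divisors, (e : ℤ) ^ (k - 1) else 0))
    (ℓ : ℕ) (hℓ : ℓ.Prime)
    (hdvd : (ℓ : ℤ) ∣ (1 + ε p * (p : ℤ) ^ j) * (1 + ε p * (p : ℤ) ^ (j - 1)))
    (n : ℕ) (hn : 1 ≤ n) :
    Int.ModEq (ℓ : ℤ) (a (p * n)) (-(ε p * (p : ℤ) ^ (j - 1)) * a n) := by
  obtain ⟨M, rfl⟩ := hpN
  have hM0 : M ≠ 0 := by
    rintro rfl
    simp at hN0
  have hpM : Nat.Coprime p M := Nat.coprime_of_squarefree_mul hN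
  have hpd : ∀ d ∈ M.divisors, ¬ p ∣ d := fun d hd h =>
    (Nat.Prime.coprime_iff_not_dvd hp).1 hpM (h.trans (Nat.dvd_of_mem_divisors hd))
  have hεp : ε p * ε p = 1 := by
    rcases hεpm p (Dvd.intro M rfl) with h | h <;> simp [h]
  have hεpd : ∀ d ∈ M.divisors, ε (p * d) = ε p * ε d := fun d hd =>
    hεmul p d (Dvd.intro M rfl) ((Nat.dvd_of_mem_divisors hd).mul_left p)
      (hpM.coprime_dvd_right (Nat.dvd_of_mem_divisors hd))
  set s : ℕ → ℕ → ℤ := fun m d =>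
    if d ∣ m then ∑ e ∈ (m / d).divisors, (e : ℤ) ^ (k - 1) else 0 with hs
  have hsplit : ∀ m, 1 ≤ m →
      a m = ∑ d ∈ M.divisors, ε d * (d : ℤ) ^ j * (s m d + ε p * (p : ℤ) ^ j * s m (p * d)) := by
    intro m hm
    rw [ha m hm, sum_divisors_prime_mul hp hM0, Finset.filter_true_of_mem hpd,
      ← Finset.sum_add_distrib]
    refine Finset.sum_congr rfl fun d hd => ?_
    rw [hεpd d hd]
    simp only [hs]
    push_cast
    ring
  have hs_mul : ∀ d, s (p * n) (p * d) = s n d := by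
    intro d
    simp only [hs, Nat.mul_dvd_mul_iff_left hp.pos, Nat.mul_div_mul_left n d hp.pos]
  have hs_hecke : ∀ d ∈ M.divisors, s (p * n) d =
      (1 + (p : ℤ) ^ (k - 1)) * s n d - (p : ℤ) ^ (k - 1) * s n (p * d) := by
    intro d hd
    have hcop : Nat.Coprime d p :=
      ((Nat.Prime.coprime_iff_not_dvd hp).2 (hpd d hd)).symm
    by_cases hdn : d ∣ n
    · obtain ⟨c, rfl⟩ := hdn
      have hd0 : 0 < d := Nat.pos_of_mem_divisors hd
      have hc : c ≠ 0 := by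
        rintro rfl
        simp at hn
      have h := sum_divisors_pow_prime_mul hp hc (k - 1)
      have h₁ : p * (d * c) / d = p * c := by
        rw [Nat.mul_left_comm, Nat.mul_div_cancel_left _ hd0]
      have h₂ : p * d ∣ d * c ↔ p ∣ c := by
        rw [Nat.mul_comm p d, Nat.mul_dvd_mul_iff_left hd0]
      have h₃ : d * c / (p * d) = c / p := by
        rw [Nat.mul_comm p d, Nat.mul_div_mul_left _ _ hd0]
      have h₄ : d ∣ p * (d * c) := (Dvd.intro c rfl).mul_left p
      simp only [hs, h₁, h₂, h₃, if_pos h₄, if_pos (Dvd.intro c rfl : d ∣ d * c),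
        Nat.mul_div_cancel_left c hd0]
      exact h
    · have h₁ : ¬ d ∣ p * n := fun h => hdn (hcop.dvd_of_dvd_mul_left h)
      have h₂ : ¬ p * d ∣ n := fun h => hdn ((Dvd.intro_left p rfl).trans h)
      simp [hs, hdn, h₁, h₂]
  have key : a (p * n) - -(ε p * (p : ℤ) ^ (j - 1)) * a n =
      (1 + ε p * (p : ℤ) ^ j) * (1 + ε p * (p : ℤ) ^ (j - 1)) *
        ∑ d ∈ M.divisors, ε d * (d : ℤ) ^ j * s n d := by
    rw [hsplit (p * n) (Nat.mul_pos hp.pos hn), hsplit n hn, Finset.mul_sum, Finset.mul_sum,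
      ← Finset.sum_sub_distrib]
    refine Finset.sum_congr rfl fun d hd => ?_
    have hpow : (p : ℤ) ^ (k - 1) = (p : ℤ) ^ j * (p : ℤ) ^ (j - 1) := by
      rw [← pow_add]
      congr 1
      omega
    rw [hs_mul, hs_hecke d hd, hpow]
    linear_combination ε d * (d : ℤ) ^ j * (p : ℤ) ^ j * (p : ℤ) ^ (j - 1) *
      (s n (p * d) - s n d) * hεp
  refine (Int.modEq_iff_dvd.2 ?_).symm
  rw [key]
  exact hdvd.mul_right _
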